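/- arXiv:1907.06448 — 2 statements merged into one kernel-verified Lean document; each statement's English description precedes it below -/
import Mathlib

section
/- Let A be an Artin algebra, M a finitely generated A-module and Λ = End_A(M), so that M is a left Λ-module via evaluation. Assume (i) M is a cogenerator over A, (ii) Ext^i_A(M,M) = 0 for 1 ≤ i ≤ n−1 for some n ≥ 1, and (iii) M-codim A ≤ m for some m ≥ 0. Then the canonical ring homomorphism A → End_Λ(M), sending a ∈ A to the map x ↦ a·x, is an isomorphism, and there exists an exact sequence 0 → Λ → I_0 → I_1 → ⋯ → I_n of left Λ-modules with each I_j a direct summand of a finite direct sum of copies of the Λ-module M (i.e., I-domdim Λ ≥ n+1 for the injective Λ-module I = Hom_A(A,M) ≅ M). -/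
open CategoryTheory

universe u

noncomputable instance hasExtModuleCat (A : Type u) [Ring A] : HasExt.{u+1} (ModuleCat.{u} A) :=
  letI := HasDerivedCategory.standard (ModuleCat.{u} A)
  hasExt_of_hasDerivedCategory _

/-- `Ext^i_A(X, Y) = 0`. -/
def ExtVanishes (A : Type u) [Ring A] (X Y : Type u) [AddCommGroup X] [Module A X]
    [AddCommGroup Y] [Module A Y] (i : ℕ) : Prop :=
  Subsingleton (Abelian.Ext (ModuleCat.of A X) (ModuleCat.of A Y) i)

/-- `X ∈ add M`: `X` is a direct summand of a finite direct sum of copies of `M`. -/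
def InAdd (Λ : Type u) [Ring Λ] (M : Type u) [AddCommGroup M] [Module Λ M]
    (X : Type u) [AddCommGroup X] [Module Λ X] : Prop :=
  ∃ (k : ℕ) (ι : X →ₗ[Λ] (Fin k → M)) (π : (Fin k → M) →ₗ[Λ] X), π ∘ₗ ι = LinearMap.id

/-- `I`-domdim of `Y` is at least `t`: there is an exact sequence
`0 → Y → J_0 → ⋯ → J_{t-1}` with all `J_i ∈ add I`. -/
def IDomdimGE (Λ : Type u) [Ring Λ] (I : Type u) [AddCommGroup I] [Module Λ I]
    (Y : Type u) [AddCommGroup Y] [Module Λ Y] (t : ℕ) : Prop :=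
  ∃ (J : ℕ → ModuleCat.{u} Λ) (g : Y →ₗ[Λ] J 0) (f : ∀ i, (J i : Type u) →ₗ[Λ] J (i+1)),
    (∀ i < t, InAdd Λ I (J i)) ∧
    (1 ≤ t → Function.Injective g) ∧
    (2 ≤ t → Function.Exact g (f 0)) ∧
    (∀ i, i + 3 ≤ t → Function.Exact (f i) (f (i+1)))

/-- The projective dimension of `N` is at most `m`: there is a projective resolution
`0 → P_m → ⋯ → P_0 → N → 0`. -/
def ProjDimLE (Λ : Type u) [Ring Λ] (N : Type u) [AddCommGroup N] [Module Λ N] (m : ℕ) : Prop :=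
  ∃ (P : ℕ → ModuleCat.{u} Λ) (f : ∀ i, (P (i+1) : Type u) →ₗ[Λ] P i) (g : (P 0 : Type u) →ₗ[Λ] N),
    (∀ i, Module.Projective Λ (P i)) ∧
    (∀ i, m < i → Subsingleton (P i)) ∧
    Function.Surjective g ∧ Function.Exact (f 0) g ∧
    (∀ i, Function.Exact (f (i+1)) (f i))

/-- The injective dimension of `N` is at most `m`: there is an injective coresolution
`0 → N → J_0 → ⋯ → J_m → 0`. -/
def InjDimLE (Λ : Type u) [Ring Λ] (N : Type u) [AddCommGroup N] [Module Λ N] (m : ℕ) : Prop :=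
  ∃ (J : ℕ → ModuleCat.{u} Λ) (g : N →ₗ[Λ] J 0) (f : ∀ i, (J i : Type u) →ₗ[Λ] J (i+1)),
    (∀ i, Module.Injective Λ (J i)) ∧
    (∀ i, m < i → Subsingleton (J i)) ∧
    Function.Injective g ∧ Function.Exact g (f 0) ∧
    (∀ i, Function.Exact (f i) (f (i+1)))

/-- `M` is a cogenerator: every finitely generated module embeds into a finite
direct sum of copies of `M`. -/
def IsCogenerator (A : Type u) [Ring A] (M : Type u) [AddCommGroup M] [Module A M] : Prop :=
  ∀ (X : Type u) [AddCommGroup X] [Module A X], Module.Finite A X →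
    ∃ (k : ℕ) (f : X →ₗ[A] (Fin k → M)), Function.Injective f

/-- `M`-codim `A ≤ m`: there is an exact sequence `0 → A → M_0 → ⋯ → M_m → 0` with all
`M_i ∈ add M` which stays exact after applying `Hom_A(-, M)`. -/
def MCodimLE (A : Type u) [Ring A] (M : Type u) [AddCommGroup M] [Module A M] (m : ℕ) : Prop :=
  ∃ (C : ℕ → ModuleCat.{u} A) (g : A →ₗ[A] C 0) (f : ∀ i, (C i : Type u) →ₗ[A] C (i+1)),
    (∀ i ≤ m, InAdd A M (C i)) ∧
    (∀ i, m < i → Subsingleton (C i)) ∧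
    Function.Injective g ∧ Function.Exact g (f 0) ∧
    (∀ i, Function.Exact (f i) (f (i+1))) ∧
    Function.Surjective (fun φ : (C 0 : Type u) →ₗ[A] M => φ ∘ₗ g) ∧
    Function.Exact (fun φ : (C 1 : Type u) →ₗ[A] M => φ ∘ₗ (f 0))
      (fun φ : (C 0 : Type u) →ₗ[A] M => φ ∘ₗ g) ∧
    (∀ i, Function.Exact (fun φ : (C (i+2) : Type u) →ₗ[A] M => φ ∘ₗ (f (i+1)))
      (fun φ : (C (i+1) : Type u) →ₗ[A] M => φ ∘ₗ (f i)))

/-- The canonical ring homomorphism from `Λ` to the endomorphism ring of `I` over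
`End_Λ(I)`, sending `λ` to multiplication by `λ`. -/
@[simps] def evalRingHom (Λ : Type u) [Ring Λ] (I : Type u) [AddCommGroup I] [Module Λ I] :
    Λ →+* Module.End (Module.End Λ I) I where
  toFun a :=
    { toFun := fun x => a • x
      map_add' := fun x y => smul_add a x y
      map_smul' := fun φ x => (φ.map_smul a x).symm }
  map_one' := by ext x; simp
  map_mul' a b := by ext x; simp [mul_smul]
  map_zero' := by ext x; simp
  map_add' a b := by ext x; simp [add_smul]

/-- If `N` is a quotient of a projective module `P` with `Ext^1_A(N, Y) = 0`, then every map from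
the kernel to `Y` extends to `P`. -/
theorem exists_extension_of_extVanishes {A : Type u} [Ring A] {P N Y : Type u}
    [AddCommGroup P] [Module A P] [AddCommGroup N] [Module A N] [AddCommGroup Y] [Module A Y]
    {p : P →ₗ[A] N} (hp : Function.Surjective p) (h : ExtVanishes A N Y 1)
    (φ : LinearMap.ker p →ₗ[A] Y) : ∃ ψ : P →ₗ[A] Y, ψ ∘ₗ (LinearMap.ker p).subtype = φ := by
  have hS := LinearMap.shortExact_shortComplexKer hp
  have : Subsingleton (Abelian.Ext (ModuleCat.of A N) (ModuleCat.of A Y) 1) := h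
  obtain ⟨x, hx⟩ := Abelian.Ext.contravariant_sequence_exact₁ hS (ModuleCat.of A Y)
    (Abelian.Ext.mk₀ (ModuleCat.ofHom φ)) (n₁ := 1) rfl
    (Subsingleton.elim (α := Abelian.Ext (ModuleCat.of A N) (ModuleCat.of A Y) 1) _ _)
  obtain ⟨ψ, rfl⟩ := (Abelian.Ext.mk₀_bijective _ _).2 x
  rw [Abelian.Ext.mk₀_comp_mk₀] at hx
  have h' := (Abelian.Ext.mk₀_bijective _ _).1 hx
  exact ⟨ψ.hom, congrArg ModuleCat.Hom.hom h'⟩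

/-- Dimension shifting along a surjection from a projective module. -/
theorem ExtVanishes.ker {A : Type u} [Ring A] {P N Y : Type u}
    [AddCommGroup P] [Module A P] [Module.Projective A P] [AddCommGroup N] [Module A N]
    [AddCommGroup Y] [Module A Y]
    {p : P →ₗ[A] N} (hp : Function.Surjective p) {i : ℕ} (h : ExtVanishes A N Y (i + 2)) :
    ExtVanishes A (LinearMap.ker p) Y (i + 1) := by
  have hS := LinearMap.shortExact_shortComplexKer hp
  have : Subsingleton (Abelian.Ext (ModuleCat.of A N) (ModuleCat.of A Y) (i + 2)) := h
  refine subsingleton_of_forall_eq 0 fun x => ?_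
  obtain ⟨y, hy⟩ := Abelian.Ext.contravariant_sequence_exact₁ hS (ModuleCat.of A Y)
    x (n₁ := i + 2) (by lia)
    (Subsingleton.elim (α := Abelian.Ext (ModuleCat.of A N) (ModuleCat.of A Y) (i + 2)) _ _)
  have : Projective (ModuleCat.of A P) := (IsProjective.iff_projective P).1 inferInstance
  have hy0 : y = 0 := Abelian.Ext.eq_zero_of_projective (P := ModuleCat.of A P) y
  rw [← hy, hy0, Abelian.Ext.comp_zero]

/-- The size of a chosen finite generating family of `N`. -/
noncomputable def freeCoverRank (A : Type u) [Ring A] (N : Type u) [AddCommGroup N] [Module A N]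
    [Module.Finite A N] : ℕ :=
  (Module.Finite.exists_fin' A N).choose

/-- A chosen surjection onto `N` from a free module of finite rank. -/
noncomputable def freeCover (A : Type u) [Ring A] (N : Type u) [AddCommGroup N] [Module A N]
    [Module.Finite A N] : (Fin (freeCoverRank A N) → A) →ₗ[A] N :=
  (Module.Finite.exists_fin' A N).choose_spec.choose

theorem freeCover_surjective (A : Type u) [Ring A] (N : Type u) [AddCommGroup N] [Module A N]
    [Module.Finite A N] : Function.Surjective (freeCover A N) :=
  (Module.Finite.exists_fin' A N).choose_spec.choose_spec

/-- The iterated kernels of the chosen free covers, starting from `N`. -/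
noncomputable def syzygy (A : Type u) [Ring A] [IsNoetherianRing A]
    (N : Type u) [AddCommGroup N] [Module A N] [Module.Finite A N] :
    ℕ → {X : ModuleCat.{u} A // Module.Finite A X}
  | 0 => ⟨ModuleCat.of A N, inferInstanceAs (Module.Finite A N)⟩
  | i + 1 =>
    haveI := (syzygy A N i).2
    ⟨ModuleCat.of A (LinearMap.ker (freeCover A (syzygy A N i).1)),
      inferInstanceAs (Module.Finite A (LinearMap.ker (freeCover A (syzygy A N i).1)))⟩

instance (A : Type u) [Ring A] [IsNoetherianRing A]
    (N : Type u) [AddCommGroup N] [Module A N] [Module.Finite A N] (i : ℕ) :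
    Module.Finite A (syzygy A N i).1 :=
  (syzygy A N i).2

theorem extVanishes_syzygy (A : Type u) [Ring A] [IsNoetherianRing A]
    (N Y : Type u) [AddCommGroup N] [Module A N] [Module.Finite A N] [AddCommGroup Y] [Module A Y]
    (i j : ℕ) (h : ExtVanishes A N Y (j + 1 + i)) : ExtVanishes A (syzygy A N i).1 Y (j + 1) := by
  induction i generalizing j with
  | zero => exact h
  | succ i ih =>
    exact ExtVanishes.ker (freeCover_surjective A (syzygy A N i).1)
      (ih (j + 1) (by convert h using 1; lia))

/-- Terms of the chosen free resolution of `N`. -/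
abbrev FreeRes (A : Type u) [Ring A] [IsNoetherianRing A]
    (N : Type u) [AddCommGroup N] [Module A N] [Module.Finite A N] (i : ℕ) : Type u :=
  Fin (freeCoverRank A (syzygy A N i).1) → A

/-- Differentials of the chosen free resolution of `N`. -/
noncomputable def freeResD (A : Type u) [Ring A] [IsNoetherianRing A]
    (N : Type u) [AddCommGroup N] [Module A N] [Module.Finite A N] (i : ℕ) :
    FreeRes A N (i + 1) →ₗ[A] FreeRes A N i :=
  (LinearMap.ker (freeCover A (syzygy A N i).1)).subtype ∘ₗ freeCover A (syzygy A N (i + 1)).1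

/-- The contravariant functoriality of `Hom_A(-, M)`, as a map of `End_A(M)`-modules. -/
def precompEnd {A : Type u} [Ring A] (M : Type u) [AddCommGroup M] [Module A M] {X Y : Type u}
    [AddCommGroup X] [Module A X] [AddCommGroup Y] [Module A Y] (d : X →ₗ[A] Y) :
    (Y →ₗ[A] M) →ₗ[Module.End A M] (X →ₗ[A] M) where
  toFun φ := φ ∘ₗ d
  map_add' _ _ := rfl
  map_smul' _ _ := rfl

theorem inAdd_hom_free (A : Type u) [Ring A] (M : Type u) [AddCommGroup M] [Module A M] (k : ℕ) :
    InAdd (Module.End A M) M ((Fin k → A) →ₗ[A] M) := by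
  refine ⟨k, ⟨⟨fun φ i => φ (Pi.single i 1), fun _ _ => rfl⟩, fun _ _ => rfl⟩,
    ⟨⟨fun v => ∑ i, (LinearMap.proj i).smulRight (v i), fun v w => ?_⟩, fun r v => ?_⟩, ?_⟩
  · ext; simp [Finset.sum_add_distrib]
  · ext; simp
  · ext φ i
    simp [Pi.single_apply, ite_smul]

theorem precompEnd_injective {A : Type u} [Ring A] (M : Type u) [AddCommGroup M] [Module A M]
    {X Y : Type u} [AddCommGroup X] [Module A X] [AddCommGroup Y] [Module A Y] {p : X →ₗ[A] Y}
    (hp : Function.Surjective p) : Function.Injective (precompEnd M p) :=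
  fun _ _ h => (LinearMap.cancel_right hp).1 h

/-- `Hom_A(-, M)` is left exact, for `K → P → N → 0` presented by a cover of the kernel. -/
theorem exact_precompEnd {A : Type u} [Ring A] (M : Type u) [AddCommGroup M] [Module A M]
    {Q P N : Type u} [AddCommGroup Q] [Module A Q] [AddCommGroup P] [Module A P] [AddCommGroup N]
    [Module A N] {p : P →ₗ[A] N} (hp : Function.Surjective p) {q : Q →ₗ[A] LinearMap.ker p}
    (hq : Function.Surjective q) :
    Function.Exact (precompEnd M p) (precompEnd M ((LinearMap.ker p).subtype ∘ₗ q)) := by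
  intro φ
  constructor
  · intro h
    have hk : φ ∘ₗ (LinearMap.ker p).subtype = 0 := (LinearMap.cancel_right hq).1 h
    have hle : LinearMap.ker p ≤ LinearMap.ker φ := fun x hx => LinearMap.congr_fun hk ⟨x, hx⟩
    refine ⟨(LinearMap.ker p).liftQ φ hle ∘ₗ (p.quotKerEquivOfSurjective hp).symm, ?_⟩
    refine LinearMap.ext fun x => ?_
    have : (p.quotKerEquivOfSurjective hp).symm (p x) = (LinearMap.ker p).mkQ x := by
      rw [LinearEquiv.symm_apply_eq]; rfl
    change (LinearMap.ker p).liftQ φ hle ((p.quotKerEquivOfSurjective hp).symm (p x)) = φ x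
    rw [this]
    simp
  · rintro ⟨ψ, rfl⟩
    refine LinearMap.ext fun x => ?_
    change ψ (p (q x)) = 0
    rw [(q x).2, map_zero]

/-- The dual of a free resolution of `N` is exact in degree `i + 1` if `Ext^(i+1)_A(N, M) = 0`. -/
theorem exact_precompEnd_freeResD (A : Type u) [Ring A] [IsNoetherianRing A] (N M : Type u)
    [AddCommGroup N] [Module A N] [Module.Finite A N] [AddCommGroup M] [Module A M] (i : ℕ)
    (h : ExtVanishes A N M (i + 1)) :
    Function.Exact (precompEnd M (freeResD A N i)) (precompEnd M (freeResD A N (i + 1))) := by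
  intro φ
  have hex := exact_precompEnd M (freeCover_surjective A (syzygy A N (i + 1)).1)
    (freeCover_surjective A (syzygy A N (i + 2)).1) φ
  refine hex.trans ⟨?_, ?_⟩
  · rintro ⟨ψ, rfl⟩
    obtain ⟨χ, rfl⟩ := exists_extension_of_extVanishes (freeCover_surjective A (syzygy A N i).1)
      (extVanishes_syzygy A N M i 0 (by convert h using 1; lia)) ψ
    exact ⟨χ, rfl⟩
  · rintro ⟨χ, rfl⟩
    exact ⟨χ ∘ₗ (LinearMap.ker (freeCover A (syzygy A N i).1)).subtype, rfl⟩

theorem iDomdimGE_end (A : Type u) [Ring A] [IsNoetherianRing A] (M : Type u) [AddCommGroup M]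
    [Module A M] [Module.Finite A M] (n : ℕ)
    (hext : ∀ i : ℕ, 1 ≤ i → i ≤ n - 1 → ExtVanishes A M M i) :
    IDomdimGE (Module.End A M) M (Module.End A M) (n + 1) := by
  refine ⟨fun i => ModuleCat.of _ (FreeRes A M i →ₗ[A] M),
    precompEnd M (freeCover A (syzygy A M 0).1),
    fun i => precompEnd M (freeResD A M i), fun i _ => inAdd_hom_free A M _,
    fun _ => precompEnd_injective M (freeCover_surjective A (syzygy A M 0).1),
    fun _ => exact_precompEnd M (freeCover_surjective A (syzygy A M 0).1)
      (freeCover_surjective A (syzygy A M 1).1),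
    fun i hi => exact_precompEnd_freeResD A M M i (hext (i + 1) (by lia) (by lia))⟩

/-- `End_{End_A(M)}(M)` acts on the summands of `Mᵏ`, naturally with respect to `A`-linear maps. -/
theorem bicommutant_natural {A : Type u} [Ring A] {M : Type u} [AddCommGroup M] [Module A M]
    (f : Module.End (Module.End A M) M) {k l : ℕ} (φ : (Fin k → M) →ₗ[A] (Fin l → M))
    (v : Fin k → M) : φ (fun i => f (v i)) = fun j => f (φ v j) := by
  have hsum (w : Fin k → M) (j : Fin l) :
      φ w j = ∑ i, (LinearMap.proj j ∘ₗ φ ∘ₗ LinearMap.single A (fun _ => M) i :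
        Module.End A M) • w i := by
    conv_lhs => rw [← LinearMap.sum_single_apply (fun _ : Fin k => M) w]
    simp
  funext j
  rw [hsum, hsum, map_sum]
  simp only [map_smul]

theorem evalRingHom_bijective_of_mCodimLE {A : Type u} [Ring A] {M : Type u} [AddCommGroup M]
    [Module A M] {m : ℕ} (h : MCodimLE A M m) : Function.Bijective (evalRingHom A M) := by
  obtain ⟨C, g, d, hadd, hsub, hg, hgd, -, hsurj, -⟩ := h
  obtain ⟨k, ι, π, hπ⟩ := hadd 0 (Nat.zero_le _)
  have hπ' (x) : π (ι x) = x := LinearMap.congr_fun hπ x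
  obtain ⟨l, ι', hι'⟩ : ∃ (l : ℕ) (ι' : C 1 →ₗ[A] (Fin l → M)), Function.Injective ι' := by
    rcases Nat.lt_or_ge m 1 with hm | hm
    · have := hsub 1 hm
      exact ⟨0, 0, Function.injective_of_subsingleton _⟩
    · obtain ⟨l, ι', π', h'⟩ := hadd 1 hm
      exact ⟨l, ι', Function.LeftInverse.injective (g := π') (LinearMap.congr_fun h')⟩
  constructor
  · rw [injective_iff_map_eq_zero]
    intro a ha
    have hM (x : M) : a • x = 0 := LinearMap.congr_fun ha x
    apply hg
    rw [map_zero, ← hπ' (g a), ← mul_one a, ← smul_eq_mul, map_smul, map_smul]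
    have : a • ι (g 1) = 0 := funext fun i => hM _
    rw [this, map_zero]
  · intro f
    have hz : d 0 (π fun i => f (ι (g 1) i)) = 0 := by
      apply hι'
      have := bicommutant_natural f (ι' ∘ₗ d 0 ∘ₗ π) (ι (g 1))
      simp only [LinearMap.comp_apply, hπ', hgd.apply_apply_eq_zero, map_zero] at this
      rw [this, map_zero]
      exact funext fun j => map_zero f
    obtain ⟨a, ha⟩ := (hgd _).1 hz
    refine ⟨a, LinearMap.ext fun x => ?_⟩
    obtain ⟨φ, hφ⟩ := hsurj (LinearMap.toSpanSingleton A M x)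
    have hφ' (b : A) : φ (g b) = b • x := LinearMap.congr_fun hφ b
    have := congrFun (bicommutant_natural f (LinearMap.pi fun _ : Fin 1 => φ ∘ₗ π) (ι (g 1))) 0
    simp only [LinearMap.pi_apply, LinearMap.comp_apply, ← ha, hπ', hφ', one_smul] at this
    exact this

/-- Under the hypotheses of Theorem 3.3, the canonical ring homomorphism
`A → End_Λ(M)` (for `Λ = End_A(M)`) is an isomorphism and `I`-domdim `Λ ≥ n+1` where
`I = M` as a `Λ`-module. -/
theorem stmt2 (R : Type u) [CommRing R] [IsArtinianRing R]
    (A : Type u) [Ring A] [Algebra R A] [Module.Finite R A]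
    (M : Type u) [AddCommGroup M] [Module A M] [Module.Finite A M]
    (n m : ℕ) (hn : 1 ≤ n)
    (hcog : IsCogenerator A M)
    (hext : ∀ i : ℕ, 1 ≤ i → i ≤ n - 1 → ExtVanishes A M M i)
    (hcodim : MCodimLE A M m) :
    Function.Bijective (evalRingHom A M) ∧
    IDomdimGE (Module.End A M) M (Module.End A M) (n + 1) := by
  have : IsNoetherianRing A := IsNoetherianRing.of_finite R A
  exact ⟨evalRingHom_bijective_of_mCodimLE hcodim, iDomdimGE_end A M n hext⟩
end

section
/- Let Λ be an Artin algebra, I a finitely generated injective left Λ-module with projective dimension at most m (m ≥ 0), and suppose I-domdim Λ ≥ n+1 for some n ≥ 1. Let A = End_Λ(I) and let M = I viewed as a left A-module. Then Ext^i_A(M,M) = 0 for 1 ≤ i ≤ n−1. -/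
open CategoryTheory

universe u

section ExtFromPartialResolution

variable {A : Type u} [Ring A] {M N : Type u} [AddCommGroup M] [Module A M]
  [AddCommGroup N] [Module A N]

/-- The short exact sequence `0 → ker ε → P → M → 0` of a surjection `ε`. -/
def kernelShortComplex {P : ModuleCat.{u} A} (ε : (P : Type u) →ₗ[A] M) :
    ShortComplex (ModuleCat.{u} A) where
  X₁ := ModuleCat.of A (LinearMap.ker ε)
  X₂ := P
  X₃ := ModuleCat.of A M
  f := ModuleCat.ofHom (LinearMap.ker ε).subtype
  g := ModuleCat.ofHom ε
  zero := by ext x; exact x.2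

theorem kernelShortComplex_shortExact {P : ModuleCat.{u} A} {ε : (P : Type u) →ₗ[A] M}
    (hε : Function.Surjective ε) : (kernelShortComplex ε).ShortExact where
  exact := by
    rw [ShortComplex.ShortExact.moduleCat_exact_iff_function_exact]
    intro x
    exact ⟨fun hx => ⟨⟨x, hx⟩, rfl⟩, by rintro ⟨y, rfl⟩; exact y.2⟩
  mono_f := (ModuleCat.mono_iff_injective _).2 (LinearMap.ker ε).injective_subtype
  epi_g := (ModuleCat.epi_iff_surjective _).2 hε

theorem extVanishes_one_of_extension {P : ModuleCat.{u} A} [Module.Projective A P]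
    {ε : (P : Type u) →ₗ[A] M} (hε : Function.Surjective ε)
    (hext : ∀ f : LinearMap.ker ε →ₗ[A] N,
      ∃ g : (P : Type u) →ₗ[A] N, g ∘ₗ (LinearMap.ker ε).subtype = f) :
    ExtVanishes A M N 1 := by
  have hS := kernelShortComplex_shortExact hε
  have : Projective (kernelShortComplex ε).X₂ :=
    (IsProjective.iff_projective (R := A) P).1 inferInstance
  refine subsingleton_of_forall_eq 0 fun x => ?_
  obtain ⟨y, rfl⟩ := Abelian.Ext.contravariant_sequence_exact₃ hS (ModuleCat.of A N) x
    (Abelian.Ext.eq_zero_of_projective _) (add_zero 1)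
  obtain ⟨f, rfl⟩ := (Abelian.Ext.mk₀_bijective _ _).2 y
  obtain ⟨g, hg⟩ := hext f.hom
  obtain ⟨G, rfl⟩ : ∃ G : (kernelShortComplex ε).X₂ ⟶ ModuleCat.of A N,
      f = (kernelShortComplex ε).f ≫ G :=
    ⟨ModuleCat.ofHom g, by ext z; exact (LinearMap.congr_fun hg z).symm⟩
  rw [← Abelian.Ext.mk₀_comp_mk₀, hS.extClass_comp_assoc]
  rfl

theorem extVanishes_succ_of_ker {P : ModuleCat.{u} A} [Module.Projective A P]
    {ε : (P : Type u) →ₗ[A] M} (hε : Function.Surjective ε) {k : ℕ}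
    (h : ExtVanishes A (LinearMap.ker ε) N (k + 1)) : ExtVanishes A M N (k + 2) := by
  have hS := kernelShortComplex_shortExact hε
  have : Projective (kernelShortComplex ε).X₂ :=
    (IsProjective.iff_projective (R := A) P).1 inferInstance
  refine subsingleton_of_forall_eq 0 fun x => ?_
  obtain ⟨y, rfl⟩ := Abelian.Ext.contravariant_sequence_exact₃ hS (ModuleCat.of A N) x
    (Abelian.Ext.eq_zero_of_projective _) (n₀ := k + 1) (by lia)
  have hy : y = 0 := @Subsingleton.elim _ h y 0
  rw [hy, Abelian.Ext.comp_zero]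
  rfl

/-- `Ext^{k+1}(M, N)` vanishes if `Hom(-, N)` is exact in degree `k + 1` on a
partial projective resolution of `M`. -/
theorem extVanishes_of_partial_resolution (k : ℕ) (P : ℕ → ModuleCat.{u} A)
    (d : ∀ i, (P (i + 1) : Type u) →ₗ[A] P i) (ε : (P 0 : Type u) →ₗ[A] M)
    (hP : ∀ j ≤ k, Module.Projective A (P j)) (hε : Function.Surjective ε)
    (hd₀ : Function.Exact (d 0) ε)
    (hd : ∀ j, j + 1 ≤ k → Function.Exact (d (j + 1)) (d j))
    (hdd : d k ∘ₗ d (k + 1) = 0)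
    (hN : ∀ φ : (P (k + 1) : Type u) →ₗ[A] N, φ ∘ₗ d (k + 1) = 0 →
      ∃ ψ : (P k : Type u) →ₗ[A] N, ψ ∘ₗ d k = φ) :
    ExtVanishes A M N (k + 1) := by
  have := hP 0 (Nat.zero_le k)
  let ε' : (P 1 : Type u) →ₗ[A] LinearMap.ker ε :=
    (d 0).codRestrict _ fun x => hd₀.apply_apply_eq_zero x
  have hε' : Function.Surjective ε' := by
    rintro ⟨x, hx⟩
    obtain ⟨y, rfl⟩ := (hd₀ x).1 hx
    exact ⟨y, rfl⟩
  induction k generalizing M P with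
  | zero =>
    refine extVanishes_one_of_extension hε fun f => ?_
    obtain ⟨ψ, hψ⟩ := hN (f ∘ₗ ε') <| by
      ext z
      have : ε' (d 1 z) = 0 := Subtype.ext (LinearMap.congr_fun hdd z)
      simp [this]
    refine ⟨ψ, LinearMap.ext fun z => ?_⟩
    obtain ⟨y, rfl⟩ := hε' z
    exact LinearMap.congr_fun hψ y
  | succ k ih =>
    refine extVanishes_succ_of_ker hε ?_
    have hd₁ : Function.Exact (d 1) ε' := fun x =>
      Subtype.ext_iff.trans (hd 0 (by lia) x)
    refine ih (fun j => P (j + 1)) (fun j => d (j + 1)) ε' (fun j hj => hP _ (by lia)) hε' hd₁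
      (fun j hj => hd _ (by lia)) hdd hN (hP 1 (by lia)) ?_
    rintro ⟨x, hx⟩
    obtain ⟨y, rfl⟩ := (hd₁ x).1 hx
    exact ⟨y, rfl⟩

end ExtFromPartialResolution

section HomToInjective

variable {Λ : Type u} [Ring Λ] {I : Type u} [AddCommGroup I] [Module Λ I]
  {X Y Z : Type u} [AddCommGroup X] [Module Λ X] [AddCommGroup Y] [Module Λ Y]
  [AddCommGroup Z] [Module Λ Z]

/-- Precomposition with `f`, as an `End_Λ(I)`-linear map `Hom(Y, I) → Hom(X, I)`. -/
def homPrecomp (I : Type u) [AddCommGroup I] [Module Λ I] (f : X →ₗ[Λ] Y) :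
    (Y →ₗ[Λ] I) →ₗ[Module.End Λ I] (X →ₗ[Λ] I) where
  toFun h := h ∘ₗ f
  map_add' _ _ := rfl
  map_smul' _ _ := rfl

/-- Evaluation at `x`, as an `End_Λ(I)`-linear map `Hom(X, I) → I`. -/
def homEval (I : Type u) [AddCommGroup I] [Module Λ I] (x : X) :
    (X →ₗ[Λ] I) →ₗ[Module.End Λ I] I where
  toFun h := h x
  map_add' _ _ := rfl
  map_smul' _ _ := rfl

theorem Module.Injective.exists_comp_eq_of_exact [Module.Injective Λ I] {f : X →ₗ[Λ] Y}
    {g : Y →ₗ[Λ] Z} (hfg : Function.Exact f g) (h : Y →ₗ[Λ] I) (hh : h ∘ₗ f = 0) :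
    ∃ h' : Z →ₗ[Λ] I, h' ∘ₗ g = h := by
  have hker : LinearMap.ker g ≤ LinearMap.ker h := by
    intro y hy
    obtain ⟨x, rfl⟩ := (hfg y).1 hy
    exact LinearMap.congr_fun hh x
  obtain ⟨h', hh'⟩ := Module.Injective.out ((LinearMap.ker g).liftQ g le_rfl)
    (LinearMap.ker_eq_bot.1 (Submodule.ker_liftQ_eq_bot' _ _ rfl))
    ((LinearMap.ker g).liftQ h hker)
  exact ⟨h', LinearMap.ext fun y => hh' (Submodule.Quotient.mk y)⟩

theorem homPrecomp_exact [Module.Injective Λ I] {f : X →ₗ[Λ] Y}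
    {g : Y →ₗ[Λ] Z} (hfg : Function.Exact f g) :
    Function.Exact (homPrecomp I g) (homPrecomp I f) := by
  intro h
  refine ⟨fun hh => Module.Injective.exists_comp_eq_of_exact hfg h hh, ?_⟩
  rintro ⟨h, rfl⟩
  exact LinearMap.ext fun x => (congrArg h (hfg.apply_apply_eq_zero x)).trans h.map_zero

theorem InAdd.eq_sum (hX : InAdd Λ I X) :
    ∃ (k : ℕ) (ι : X →ₗ[Λ] (Fin k → I)) (π : (Fin k → I) →ₗ[Λ] X), π ∘ₗ ι = LinearMap.id ∧
      ∀ h : X →ₗ[Λ] I, h = ∑ a, (h ∘ₗ π ∘ₗ LinearMap.single Λ (fun _ => I) a : Module.End Λ I) •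
        (LinearMap.proj a ∘ₗ ι : X →ₗ[Λ] I) := by
  obtain ⟨k, ι, π, hπ⟩ := hX
  refine ⟨k, ι, π, hπ, fun h => LinearMap.ext fun x => ?_⟩
  conv_lhs => rw [← LinearMap.id_apply (R := Λ) x, ← hπ, LinearMap.comp_apply,
    ← Finset.univ_sum_single (ι x), map_sum, map_sum]
  simp

theorem InAdd.projective_hom (hX : InAdd Λ I X) :
    Module.Projective (Module.End Λ I) (X →ₗ[Λ] I) := by
  obtain ⟨k, ι, π, -, hsum⟩ := hX.eq_sum
  let i : (X →ₗ[Λ] I) →ₗ[Module.End Λ I] (Fin k → Module.End Λ I) :=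
    { toFun := fun h a => h ∘ₗ π ∘ₗ LinearMap.single Λ (fun _ => I) a
      map_add' := fun _ _ => rfl
      map_smul' := fun _ _ => rfl }
  exact Module.Projective.of_split i
    (Fintype.linearCombination (Module.End Λ I) fun a : Fin k =>
      (LinearMap.proj (R := Λ) (φ := fun _ => I) a ∘ₗ ι : X →ₗ[Λ] I))
    (LinearMap.ext fun h => (hsum h).symm)

theorem InAdd.exists_eq_homEval (hX : InAdd Λ I X) (φ : (X →ₗ[Λ] I) →ₗ[Module.End Λ I] I) :
    ∃ x : X, φ = homEval I x := by
  obtain ⟨k, ι, π, -, hsum⟩ := hX.eq_sum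
  refine ⟨π fun a => φ (LinearMap.proj a ∘ₗ ι), LinearMap.ext fun h => ?_⟩
  change _ = h (π _)
  conv_lhs => rw [hsum h, map_sum]
  conv_rhs => rw [← Finset.univ_sum_single (fun a => φ (LinearMap.proj a ∘ₗ ι)), map_sum, map_sum]
  exact Finset.sum_congr rfl fun a _ => by rw [map_smul]; rfl

theorem InAdd.eq_zero_of_forall_hom (hX : InAdd Λ I X) {x : X}
    (hx : ∀ h : X →ₗ[Λ] I, h x = 0) : x = 0 := by
  obtain ⟨k, ι, π, hπ⟩ := hX
  have hι : ι x = 0 := funext fun a => hx (LinearMap.proj a ∘ₗ ι)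
  rw [← LinearMap.id_apply (R := Λ) x, ← hπ, LinearMap.comp_apply, hι, map_zero]

end HomToInjective

/-- If `I` is a finitely generated injective module over the Artin algebra `Λ`
with projective dimension at most `m` and `I`-domdim `Λ ≥ n+1` (`n ≥ 1`), then for
`A = End_Λ(I)` and `M = I` viewed as an `A`-module, `Ext^i_A(M,M) = 0` for `1 ≤ i ≤ n-1`. -/
theorem stmt7 (R : Type u) [CommRing R] [IsArtinianRing R]
    (Λ : Type u) [Ring Λ] [Algebra R Λ] [Module.Finite R Λ]
    (I : Type u) [AddCommGroup I] [Module Λ I] [Module.Finite Λ I]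
    (hIinj : Module.Injective Λ I)
    (m n : ℕ) (hn : 1 ≤ n)
    (hpd : ProjDimLE Λ I m)
    (hdom : IDomdimGE Λ I Λ (n + 1)) :
    ∀ i : ℕ, 1 ≤ i → i ≤ n - 1 → ExtVanishes (Module.End Λ I) I I i := by
  intro i hi hin
  obtain ⟨k, rfl⟩ := Nat.exists_eq_add_of_le' hi
  obtain ⟨J, g, f, hJ, hg, hgf, hf⟩ := hdom
  have hgf := hgf (by lia)
  have hev (h : (J 0 : Type u) →ₗ[Λ] I) : homEval I (g 1) h = 0 ↔ homPrecomp I g h = 0 :=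
    ⟨fun hh => LinearMap.ext_ring hh, fun hh => LinearMap.congr_fun hh 1⟩
  refine extVanishes_of_partial_resolution k
    (fun j => ModuleCat.of (Module.End Λ I) ((J j : Type u) →ₗ[Λ] I))
    (fun j => homPrecomp I (f j)) (homEval I (g 1))
    (fun j hj => (hJ j (by lia)).projective_hom) (fun y => ?_)
    (fun h => (hev h).trans (homPrecomp_exact hgf h))
    (fun j hj => homPrecomp_exact (hf j (by lia))) ?_ fun φ hφ => ?_
  · obtain ⟨h, hh⟩ := hIinj.out g (hg (by lia)) (LinearMap.toSpanSingleton Λ I y)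
    exact ⟨h, (hh 1).trans (one_smul Λ y)⟩
  · exact (homPrecomp_exact (hf k (by lia))).linearMap_comp_eq_zero
  · obtain ⟨x, rfl⟩ := (hJ (k + 1) (by lia)).exists_eq_homEval φ
    have hx : f (k + 1) x = 0 :=
      (hJ (k + 2) (by lia)).eq_zero_of_forall_hom fun h => LinearMap.congr_fun hφ h
    obtain ⟨y, rfl⟩ := (hf k (by lia) x).1 hx
    exact ⟨homEval I y, rfl⟩
end
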